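/- Let g(x) = τx + τΔ_1 and h(x) = -x^T x + (τx+τΔ_1)^T(τx+τΔ_1) - 2log|τ|. For a unit vector a ∈ R^p and any t ∈ R, the CDF of a^T T_H satisfies F_{a^T T_H}(t) - Φ(t) = π_1[Φ_p(g^{-1}(R_2) ∩ R_3) - Φ_p(R_2 ∩ R_3)] + π_2[Φ_p(g(R_2) ∩ g(R_3^c)) - Φ_p(R_2 ∩ g(R_3^c))], where R_2 = {x : a^T x < t}, R_3 = {x : h(x) < π_0}, Φ_p(A) = P(Z ∈ A) for Z ~ N(0,I_p), and Φ is the standard normal CDF. -/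

import Mathlib

open Matrix MeasureTheory ProbabilityTheory Filter

/-- Multivariate Gaussian density `φ(y; μ, Σ)` on `ℝ^p`. -/
noncomputable def gphi (p : ℕ) (μ : Fin p → ℝ) (Sig : Matrix (Fin p) (Fin p) ℝ)
    (y : Fin p → ℝ) : ℝ :=
  (2 * Real.pi) ^ (-(p : ℝ) / 2) * Sig.det ^ (-(1 : ℝ) / 2)
    * Real.exp (-((y - μ) ⬝ᵥ Sig⁻¹.mulVec (y - μ)) / 2)

/-- Posterior probability `w₁ = π₁ φ₁(y)/(π₁ φ₁(y) + π₂ φ₂(y))` of class 1. -/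
noncomputable def wpost (p : ℕ) (μ₁ μ₂ : Fin p → ℝ)
    (Sig₁ Sig₂ : Matrix (Fin p) (Fin p) ℝ) (π₁ π₂ : ℝ) (y : Fin p → ℝ) : ℝ :=
  π₁ * gphi p μ₁ Sig₁ y / (π₁ * gphi p μ₁ Sig₁ y + π₂ * gphi p μ₂ Sig₂ y)

lemma aux_pi_ac (n : ℕ) :
    (Measure.pi fun _ : Fin n => gaussianReal 0 1) ≪ (volume : Measure (Fin n → ℝ)) := by
  induction n with
  | zero =>
    rw [volume_pi]
    rw [Measure.pi_of_empty, Measure.pi_of_empty]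
  | succ n ih =>
    have h1 := (measurePreserving_piFinSuccAbove (fun _ : Fin (n+1) => gaussianReal 0 1) 0).symm
    have h2 := (measurePreserving_piFinSuccAbove
      (fun _ : Fin (n+1) => (volume : Measure ℝ)) 0).symm
    rw [volume_pi, ← h1.map_eq, ← h2.map_eq]
    refine Measure.AbsolutelyContinuous.map ?_ (MeasurableEquiv.measurable _)
    refine Measure.AbsolutelyContinuous.prod ?_ ?_
    · exact gaussianReal_absolutelyContinuous 0 one_ne_zero
    · exact ih

lemma aux_map_dot (n : ℕ) (a : Fin n → ℝ) (ha : ∑ i, a i ^ 2 = 1) (t : ℝ) :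
    (Measure.pi fun _ : Fin n => gaussianReal 0 1) {x | a ⬝ᵥ x < t}
      = gaussianReal 0 1 (Set.Iio t) := by
  let L : StrongDual ℝ (EuclideanSpace ℝ (Fin n)) := innerSL ℝ (WithLp.toLp 2 a)
  have h1 : (stdGaussian (EuclideanSpace ℝ (Fin n))).map L = gaussianReal 0 1 := by
    rw [IsGaussian.map_eq_gaussianReal, integral_strongDual_stdGaussian,
      variance_dual_stdGaussian]
    congr 1
    have : ‖L‖ ^ 2 = 1 := by
      simp only [L, innerSL_apply_norm]
      rw [EuclideanSpace.norm_sq_eq]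
      simpa using ha
    rw [this]; simp
  have h2 : gaussianReal 0 1 (Set.Iio t)
      = (stdGaussian (EuclideanSpace ℝ (Fin n))).map L (Set.Iio t) := by rw [h1]
  rw [h2, ← map_pi_eq_stdGaussian, Measure.map_map (by fun_prop) (by fun_prop),
    Measure.map_apply (by fun_prop) measurableSet_Iio]
  congr 1
  ext x
  simp [L, PiLp.inner_apply, dotProduct, mul_comm]

lemma aux_line_null (n : ℕ) (h : (Fin n → ℝ) → ℝ) (hm : Measurable h) (k : ℝ) (v : Fin n → ℝ)
    (hq : ∀ y, ∃ A B C : ℝ, (A ≠ 0 ∨ B ≠ 0) ∧ ∀ s : ℝ, h (y + s • v) = A * (s * s) + B * s + C) :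
    (volume : Measure (Fin n → ℝ)) {x | h x = k} = 0 := by
  have := ae_mem_of_ae_add_linearMap_mem (LinearMap.toSpanSingleton ℝ (Fin n → ℝ) v)
    (volume : Measure ℝ) (volume : Measure (Fin n → ℝ)) (s := {x | h x = k}ᶜ)
    (hm (measurableSet_singleton k)).compl ?_
  · rw [ae_iff] at this
    simpa using this
  · intro y
    obtain ⟨A, B, C, hAB, hs⟩ := hq y
    rw [ae_iff]
    refine Set.Finite.measure_zero ?_ _
    simp only [LinearMap.toSpanSingleton_apply, Set.mem_compl_iff, Set.mem_ofPred_eq, hs, not_not]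
    let P : Polynomial ℝ := Polynomial.C A * Polynomial.X ^ 2 + Polynomial.C B * Polynomial.X
      + Polynomial.C (C - k)
    have hP : P ≠ 0 := by
      intro h0
      have e2 : P.coeff 2 = A := by simp [P, Polynomial.coeff_X, Polynomial.coeff_C]
      have e1 : P.coeff 1 = B := by simp [P, Polynomial.coeff_X, Polynomial.coeff_C]
      rw [h0] at e1 e2
      simp at e1 e2
      rcases hAB with h | h
      · exact h e2.symm
      · exact h e1.symm
    refine (Polynomial.finite_setOfPred_isRoot hP).subset ?_
    intro s hs
    simp only [Set.mem_ofPred_eq] at hs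
    simp [P, Polynomial.IsRoot]
    linarith

lemma aux_gphi (p : ℕ) (μ : Fin p → ℝ) (Sig S : Matrix (Fin p) (Fin p) ℝ) (hS : S.PosDef)
    (hsq : S * S = Sig) (y : Fin p → ℝ) :
    gphi p μ Sig y = (2 * Real.pi) ^ (-(p : ℝ) / 2) * (S.det)⁻¹
      * Real.exp (-(S⁻¹.mulVec (y - μ) ⬝ᵥ S⁻¹.mulVec (y - μ)) / 2) := by
  have hd := hS.det_pos
  have hT : (S⁻¹)ᵀ = S⁻¹ := by
    rw [← conjTranspose_eq_transpose_of_trivial]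
    exact hS.isHermitian.inv
  unfold gphi
  congr 2
  · rw [← hsq, det_mul, ← sq, ← Real.rpow_natCast, ← Real.rpow_mul hd.le, ← Real.rpow_neg_one]
    norm_num
  · rw [← hsq, Matrix.mul_inv_rev, ← Matrix.mulVec_mulVec, Matrix.dotProduct_mulVec,
      ← Matrix.mulVec_transpose, hT]

lemma aux_decision (A B d₁ d₂ C q₁ q₂ : ℝ) (hA : 0 < A) (hB : 0 < B) (h₁ : 0 < d₁) (h₂ : 0 < d₂)
    (hC : 0 < C) :
    1 / 2 < A * (C * d₁⁻¹ * Real.exp (-q₁ / 2)) / (A * (C * d₁⁻¹ * Real.exp (-q₁ / 2)) +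
      B * (C * d₂⁻¹ * Real.exp (-q₂ / 2))) ↔
    2 * Real.log (B / A) < -q₁ + q₂ - 2 * Real.log (d₂⁻¹ * d₁) := by
  have e1 : Real.log (A * (C * d₁⁻¹ * Real.exp (-q₁ / 2)))
      = Real.log A + (Real.log C - Real.log d₁ - q₁ / 2) := by
    rw [Real.log_mul (by positivity) (by positivity), Real.log_mul (by positivity) (by positivity),
      Real.log_mul (by positivity) (by positivity), Real.log_inv, Real.log_exp]
    ring
  have e2 : Real.log (B * (C * d₂⁻¹ * Real.exp (-q₂ / 2)))
      = Real.log B + (Real.log C - Real.log d₂ - q₂ / 2) := by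
    rw [Real.log_mul (by positivity) (by positivity), Real.log_mul (by positivity) (by positivity),
      Real.log_mul (by positivity) (by positivity), Real.log_inv, Real.log_exp]
    ring
  have p1 : 0 < A * (C * d₁⁻¹ * Real.exp (-q₁ / 2)) := by positivity
  have p2 : 0 < B * (C * d₂⁻¹ * Real.exp (-q₂ / 2)) := by positivity
  rw [Real.log_div hB.ne' hA.ne', Real.log_mul (by positivity) (by positivity), Real.log_inv]
  have : 1 / 2 < A * (C * d₁⁻¹ * Real.exp (-q₁ / 2)) / (A * (C * d₁⁻¹ * Real.exp (-q₁ / 2)) +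
      B * (C * d₂⁻¹ * Real.exp (-q₂ / 2))) ↔ B * (C * d₂⁻¹ * Real.exp (-q₂ / 2)) <
      A * (C * d₁⁻¹ * Real.exp (-q₁ / 2)) := by
    rw [lt_div_iff₀ (by positivity)]
    constructor <;> intro h <;> linarith
  rw [this, ← Real.log_lt_log_iff p2 p1, e1, e2]
  constructor <;> intro h <;> linarith

/-- Either `h` has null level sets, or `S₁ = S₂` and `Δ = 0`. -/
lemma aux_dichotomy (p : ℕ) (S₁ S₂ τ : Matrix (Fin p) (Fin p) ℝ) (Δ : Fin p → ℝ)
    (hS₁ : S₁.PosDef) (hS₂ : S₂.PosDef) (hτ : τ = S₂⁻¹ * S₁) (k l : ℝ) :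
    (volume : Measure (Fin p → ℝ)) {x | -(x ⬝ᵥ x) +
      (τ.mulVec x + τ.mulVec Δ) ⬝ᵥ (τ.mulVec x + τ.mulVec Δ) - l = k} = 0 ∨
    (τ = 1 ∧ Δ = 0) := by
  have hm : Measurable fun x : Fin p → ℝ => -(x ⬝ᵥ x) +
      (τ.mulVec x + τ.mulVec Δ) ⬝ᵥ (τ.mulVec x + τ.mulVec Δ) - l := by
    apply Continuous.measurable
    fun_prop
  have hexp : ∀ (y v : Fin p → ℝ) (s : ℝ), -((y + s • v) ⬝ᵥ (y + s • v)) +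
      (τ.mulVec (y + s • v) + τ.mulVec Δ) ⬝ᵥ (τ.mulVec (y + s • v) + τ.mulVec Δ) - l =
      (τ.mulVec v ⬝ᵥ τ.mulVec v - v ⬝ᵥ v) * (s * s) +
      (2 * ((τ.mulVec v) ⬝ᵥ (τ.mulVec y + τ.mulVec Δ)) - 2 * (v ⬝ᵥ y)) * s +
      (-(y ⬝ᵥ y) + (τ.mulVec y + τ.mulVec Δ) ⬝ᵥ (τ.mulVec y + τ.mulVec Δ) - l) := by
    intro y v s
    simp only [Matrix.mulVec_add, Matrix.mulVec_smul, dotProduct_add, add_dotProduct,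
      smul_dotProduct, dotProduct_smul, smul_eq_mul]
    rw [dotProduct_comm y v, dotProduct_comm (τ.mulVec y) (τ.mulVec v),
      dotProduct_comm (τ.mulVec Δ) (τ.mulVec v)]
    ring
  by_cases hv : ∃ v : Fin p → ℝ, τ.mulVec v ⬝ᵥ τ.mulVec v - v ⬝ᵥ v ≠ 0
  · left
    obtain ⟨v, hv⟩ := hv
    exact aux_line_null p _ hm k v fun y => ⟨_, _, _, Or.inl hv, hexp y v⟩
  · push Not at hv
    have u1 : IsUnit S₁.det := hS₁.det_pos.ne'.isUnit
    have u2 : IsUnit S₂.det := hS₂.det_pos.ne'.isUnit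
    have hbil : ∀ v w, τ.mulVec v ⬝ᵥ τ.mulVec w = v ⬝ᵥ w := by
      intro v w
      have h1 := hv (v + w)
      have h2 := hv v
      have h3 := hv w
      simp only [Matrix.mulVec_add, dotProduct_add, add_dotProduct] at h1
      rw [dotProduct_comm w v, dotProduct_comm (τ.mulVec w) (τ.mulVec v)] at h1
      linarith
    have hτ1 : τ = 1 := by
      have hTT : τᵀ * τ = 1 := by
        apply Matrix.ext_of_mulVec_single
        intro i
        apply dotProduct_eq
        intro w
        rw [← Matrix.mulVec_mulVec, Matrix.one_mulVec, Matrix.mulVec_transpose,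
          ← Matrix.dotProduct_mulVec, hbil]
      have t1 : S₁ᵀ = S₁ := by
        rw [← conjTranspose_eq_transpose_of_trivial]
        exact hS₁.isHermitian
      have t2 : (S₂⁻¹)ᵀ = S₂⁻¹ := by
        rw [← conjTranspose_eq_transpose_of_trivial]
        exact hS₂.isHermitian.inv
      rw [hτ, Matrix.transpose_mul, t1, t2] at hTT
      have hTT' : (S₂⁻¹ * S₁) * (S₁ * S₂⁻¹) = 1 := mul_eq_one_comm.mp hTT
      have hsq : S₁ * S₁ = S₂ * S₂ := by
        have : S₂ * ((S₂⁻¹ * S₁) * (S₁ * S₂⁻¹)) * S₂ = S₂ * 1 * S₂ := by rw [hTT']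
        rw [Matrix.mul_one] at this
        rw [← this]
        simp only [Matrix.mul_assoc, Matrix.nonsing_inv_mul _ u2, Matrix.mul_one]
        rw [Matrix.mul_nonsing_inv_cancel_left _ _ u2]
      have : S₁ = S₂ := by
        open scoped MatrixOrder Matrix.Norms.L2Operator in
        have a1 := CFC.sqrt_unique (a := S₁ * S₁) rfl hS₁.posSemidef.nonneg
        have a2 := CFC.sqrt_unique (a := S₁ * S₁) hsq.symm hS₂.posSemidef.nonneg
        rw [← a1, a2]
      rw [hτ, this, Matrix.nonsing_inv_mul _ u2]
    by_cases hΔ : Δ = 0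
    · right; exact ⟨hτ1, hΔ⟩
    · left
      refine aux_line_null p _ hm k Δ fun y => ⟨_, _, _, Or.inr ?_, hexp y Δ⟩
      rw [hτ1]
      simp only [Matrix.one_mulVec, dotProduct_add]
      have : Δ ⬝ᵥ Δ ≠ 0 := by
        rwa [Ne, dotProduct_self_eq_zero]
      intro h
      apply this
      linarith

/-- Theorem 2: exact CDF of a contrast of the hard-assignment
standardized score. With `g(x) = τx + τΔ₁`,
`h(x) = -xᵀx + (τx+τΔ₁)ᵀ(τx+τΔ₁) - 2log|τ|`, `R₂ = {x : aᵀx < t}`,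
`R₃ = {x : h(x) < π₀}`, `Φ_p(A) = P(Z ∈ A)` for `Z ~ N(0, I_p)` and `Φ` the standard
normal CDF,
`F_{aᵀT_H}(t) - Φ(t) = π₁[Φ_p(g⁻¹(R₂) ∩ R₃) - Φ_p(R₂ ∩ R₃)]
  + π₂[Φ_p(g(R₂) ∩ g(R₃ᶜ)) - Φ_p(R₂ ∩ g(R₃ᶜ))]`. -/
theorem stmt10 {Ω : Type*} [MeasurableSpace Ω] (P : Measure Ω) [IsProbabilityMeasure P]
    (p : ℕ) (μ₁ μ₂ : Fin p → ℝ)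
    (Sig₁ Sig₂ S₁ S₂ : Matrix (Fin p) (Fin p) ℝ)
    (hSig₁ : Sig₁.PosDef) (hSig₂ : Sig₂.PosDef)
    (hS₁ : S₁.PosDef) (hS₂ : S₂.PosDef)
    (hsq₁ : S₁ * S₁ = Sig₁) (hsq₂ : S₂ * S₂ = Sig₂)
    (π₁ π₂ π₀ : ℝ) (hπ₁ : π₁ ∈ Set.Ioo (0 : ℝ) 1) (hπsum : π₁ + π₂ = 1)
    (hπ₀ : π₀ = 2 * Real.log (π₂ / π₁))
    (Δ₁ : Fin p → ℝ) (τ : Matrix (Fin p) (Fin p) ℝ)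
    (hΔ : Δ₁ = S₁⁻¹.mulVec (μ₁ - μ₂)) (hτ : τ = S₂⁻¹ * S₁)
    (Z : Ω → Fin p → ℝ) (c : Ω → Fin 2)
    (hZmeas : Measurable Z) (hcmeas : Measurable c)
    (hZ : Measure.map Z P = Measure.pi fun _ : Fin p => gaussianReal 0 1)
    (hc : P {ω | c ω = 1} = ENNReal.ofReal π₁)
    (hindep : IndepFun Z c P)
    (Y : Ω → Fin p → ℝ)
    (hY : ∀ ω, Y ω = if c ω = 1 then S₁.mulVec (Z ω) + μ₁ else S₂.mulVec (Z ω) + μ₂)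
    -- hard-assignment standardized score T_H:
    (TH : Ω → Fin p → ℝ)
    (hTH : ∀ ω, TH ω =
      if 1 / 2 < wpost p μ₁ μ₂ Sig₁ Sig₂ π₁ π₂ (Y ω)
      then S₁⁻¹.mulVec (Y ω - μ₁) else S₂⁻¹.mulVec (Y ω - μ₂))
    (a : Fin p → ℝ) (ha : ∑ i, a i ^ 2 = 1) (t : ℝ)
    -- the maps g, h and the regions R₂, R₃:
    (g : (Fin p → ℝ) → (Fin p → ℝ)) (hg : g = fun x => τ.mulVec x + τ.mulVec Δ₁)
    (h : (Fin p → ℝ) → ℝ)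
    (hh : h = fun x => -(x ⬝ᵥ x) + (τ.mulVec x + τ.mulVec Δ₁) ⬝ᵥ (τ.mulVec x + τ.mulVec Δ₁)
      - 2 * Real.log τ.det)
    (R₂ R₃ : Set (Fin p → ℝ)) (hR₂ : R₂ = {x | a ⬝ᵥ x < t}) (hR₃ : R₃ = {x | h x < π₀})
    -- Φ_p, Φ and the CDF of aᵀT_H:
    (Φp : Set (Fin p → ℝ) → ℝ)
    (hΦp : Φp = fun A => ((Measure.pi fun _ : Fin p => gaussianReal 0 1) A).toReal)
    (Φ : ℝ → ℝ) (hΦ : Φ = fun s => ((gaussianReal 0 1) (Set.Iio s)).toReal)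
    (F : ℝ → ℝ) (hF : F = fun s => (P {ω | a ⬝ᵥ TH ω < s}).toReal) :
    F t - Φ t
      = π₁ * (Φp (g ⁻¹' R₂ ∩ R₃) - Φp (R₂ ∩ R₃))
        + π₂ * (Φp (g '' R₂ ∩ g '' R₃ᶜ) - Φp (R₂ ∩ g '' R₃ᶜ)) := by
  subst hΔ hF hΦ hΦp hR₂ hR₃ hπ₀
  obtain ⟨hπ0, hπ1⟩ := hπ₁
  have hπ2 : 0 < π₂ := by linarith
  have u1 : IsUnit S₁.det := hS₁.det_pos.ne'.isUnit
  have u2 : IsUnit S₂.det := hS₂.det_pos.ne'.isUnit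
  set γ : Measure (Fin p → ℝ) := Measure.pi fun _ : Fin p => gaussianReal 0 1 with hγ
  set k : ℝ := 2 * Real.log (π₂ / π₁) with hk
  -- `g` in terms of the original parameters
  have hg1 : ∀ x, g x = S₂⁻¹.mulVec (S₁.mulVec x + μ₁ - μ₂) := by
    intro x
    rw [hg, hτ]
    simp only [← Matrix.mulVec_add, ← Matrix.mulVec_mulVec]
    congr 1
    rw [Matrix.mulVec_add, Matrix.mulVec_mulVec, Matrix.mul_nonsing_inv _ u1, Matrix.one_mulVec]
    abel
  let gi : (Fin p → ℝ) → (Fin p → ℝ) := fun z => S₁⁻¹.mulVec (S₂.mulVec z + μ₂ - μ₁)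
  have hgi : ∀ z, gi z = S₁⁻¹.mulVec (S₂.mulVec z + μ₂ - μ₁) := fun _ => rfl
  have hl : Function.LeftInverse gi g := by
    intro x
    rw [hgi, hg1, Matrix.mulVec_mulVec, Matrix.mul_nonsing_inv _ u2, Matrix.one_mulVec]
    have : S₁.mulVec x + μ₁ - μ₂ + μ₂ - μ₁ = S₁.mulVec x := by abel
    rw [this, Matrix.mulVec_mulVec, Matrix.nonsing_inv_mul _ u1, Matrix.one_mulVec]
  have hr : Function.RightInverse gi g := by
    intro x
    rw [hg1, hgi, Matrix.mulVec_mulVec, Matrix.mul_nonsing_inv _ u1, Matrix.one_mulVec]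
    have : S₂.mulVec x + μ₂ - μ₁ + μ₁ - μ₂ = S₂.mulVec x := by abel
    rw [this, Matrix.mulVec_mulVec, Matrix.nonsing_inv_mul _ u2, Matrix.one_mulVec]
  have hgc : Measurable g := by
    apply Continuous.measurable; rw [hg]; fun_prop
  have hgim : Measurable gi := by
    apply Continuous.measurable; simp only [gi]; fun_prop
  have hhm : Measurable h := by
    apply Continuous.measurable; rw [hh]; fun_prop
  have ham : Measurable fun x : Fin p → ℝ => a ⬝ᵥ x := by
    apply Continuous.measurable; fun_prop
  -- decision rule
  have hdec : ∀ y, 1 / 2 < wpost p μ₁ μ₂ Sig₁ Sig₂ π₁ π₂ y ↔ k < h (S₁⁻¹.mulVec (y - μ₁)) := by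
    intro y
    unfold wpost
    rw [aux_gphi p μ₁ Sig₁ S₁ hS₁ hsq₁, aux_gphi p μ₂ Sig₂ S₂ hS₂ hsq₂,
      aux_decision _ _ _ _ _ _ _ hπ0 hπ2 hS₁.det_pos hS₂.det_pos (by positivity)]
    have e : g (S₁⁻¹.mulVec (y - μ₁)) = S₂⁻¹.mulVec (y - μ₂) := by
      rw [hg1, Matrix.mulVec_mulVec, Matrix.mul_nonsing_inv _ u1, Matrix.one_mulVec]
      congr 1; abel
    have e2 : h (S₁⁻¹.mulVec (y - μ₁)) = -(S₁⁻¹.mulVec (y - μ₁) ⬝ᵥ S₁⁻¹.mulVec (y - μ₁)) +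
        g (S₁⁻¹.mulVec (y - μ₁)) ⬝ᵥ g (S₁⁻¹.mulVec (y - μ₁)) - 2 * Real.log τ.det := by
      rw [hh, hg]
    have e3 : τ.det = S₂.det⁻¹ * S₁.det := by
      rw [hτ, det_mul, Matrix.det_nonsing_inv, Ring.inverse_eq_inv']
    rw [e2, e, e3]
  -- events
  let E₁ : Set (Fin p → ℝ) := {x | if k < h x then a ⬝ᵥ x < t else a ⬝ᵥ g x < t}
  let E₂ : Set (Fin p → ℝ) := {z | if k < h (gi z) then a ⬝ᵥ gi z < t else a ⬝ᵥ z < t}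
  have hE₁ : MeasurableSet E₁ := by
    have : E₁ = {x | a ⬝ᵥ (if k < h x then x else g x) < t} := by
      ext x
      simp only [E₁, Set.mem_ofPred_eq]
      split_ifs <;> rfl
    rw [this]
    exact measurableSet_lt (ham.comp (Measurable.ite (measurableSet_lt measurable_const hhm)
      measurable_id hgc)) measurable_const
  have hE₂ : MeasurableSet E₂ := by
    have : E₂ = {x | a ⬝ᵥ (if k < h (gi x) then gi x else x) < t} := by
      ext x
      simp only [E₂, Set.mem_ofPred_eq]
      split_ifs <;> rfl
    rw [this]
    exact measurableSet_lt (ham.comp (Measurable.ite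
      (measurableSet_lt measurable_const (hhm.comp hgim)) hgim measurable_id)) measurable_const
  have hTH1 : ∀ ω, c ω = 1 → (a ⬝ᵥ TH ω < t ↔ Z ω ∈ E₁) := by
    intro ω hω
    have e1 : S₁⁻¹.mulVec (Y ω - μ₁) = Z ω := by
      rw [hY, if_pos hω, add_sub_cancel_right, Matrix.mulVec_mulVec,
        Matrix.nonsing_inv_mul _ u1, Matrix.one_mulVec]
    have e2 : S₂⁻¹.mulVec (Y ω - μ₂) = g (Z ω) := by
      rw [hY, if_pos hω, hg1]
    rw [hTH, e1, e2]
    simp only [hdec, e1, E₁, Set.mem_ofPred_eq]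
    split_ifs <;> rfl
  have hTH2 : ∀ ω, c ω ≠ 1 → (a ⬝ᵥ TH ω < t ↔ Z ω ∈ E₂) := by
    intro ω hω
    have e1 : S₁⁻¹.mulVec (Y ω - μ₁) = gi (Z ω) := by
      rw [hY, if_neg hω, hgi]
    have e2 : S₂⁻¹.mulVec (Y ω - μ₂) = Z ω := by
      rw [hY, if_neg hω, add_sub_cancel_right, Matrix.mulVec_mulVec,
        Matrix.nonsing_inv_mul _ u2, Matrix.one_mulVec]
    rw [hTH, e1, e2]
    simp only [hdec, e1, E₂, Set.mem_ofPred_eq]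
    split_ifs <;> rfl
  have hγZ : ∀ E, MeasurableSet E → P (Z ⁻¹' E) = γ E := by
    intro E hE
    rw [← hZ, Measure.map_apply hZmeas hE]
  have hcreal : P.real (c ⁻¹' {1}) = π₁ := by
    have : P (c ⁻¹' {1}) = ENNReal.ofReal π₁ := hc
    rw [measureReal_def, this, ENNReal.toReal_ofReal hπ0.le]
  have hcreal' : P.real (c ⁻¹' {1}ᶜ) = π₂ := by
    rw [Set.preimage_compl, probReal_compl_eq_one_sub (hcmeas (measurableSet_singleton _)), hcreal]
    linarith
  have hind : ∀ E, MeasurableSet E → ∀ s : Set (Fin 2),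
      P.real (Z ⁻¹' E ∩ c ⁻¹' s) = γ.real E * P.real (c ⁻¹' s) := by
    intro E hE s
    have := hindep.measure_inter_preimage_eq_mul E s hE s.toFinite.measurableSet
    rw [measureReal_def, this, ENNReal.toReal_mul, hγZ E hE]; rfl
  have hFt : P.real {ω | a ⬝ᵥ TH ω < t} = π₁ * γ.real E₁ + π₂ * γ.real E₂ := by
    have : {ω | a ⬝ᵥ TH ω < t} = (Z ⁻¹' E₁ ∩ c ⁻¹' {1}) ∪ (Z ⁻¹' E₂ ∩ c ⁻¹' {1}ᶜ) := by
      ext ω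
      by_cases hω : c ω = 1
      · simp [hω, hTH1 ω hω]
      · simp [hω, hTH2 ω hω]
    rw [this, measureReal_union, hind _ hE₁, hind _ hE₂, hcreal, hcreal']
    · ring
    · rw [Set.disjoint_left]
      rintro ω ⟨-, h1⟩ ⟨-, h2⟩
      exact h2 h1
    · exact (hZmeas hE₂).inter (hcmeas (Set.toFinite _).measurableSet)
  -- the boundary is negligible
  have hbd : (∀ᵐ x ∂γ, g x = x ∨ h x ≠ k) ∧ (∀ᵐ z ∂γ, gi z = z ∨ h (gi z) ≠ k) := by
    rcases aux_dichotomy p S₁ S₂ τ (S₁⁻¹.mulVec (μ₁ - μ₂)) hS₁ hS₂ hτ k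
      (2 * Real.log τ.det) with h0 | ⟨h1, h2⟩
    · have h0' : volume {x | h x = k} = 0 := by rw [hh]; exact h0
      have h0'' : volume (g '' {x | h x = k}) = 0 := by
        refine addHaar_image_eq_zero_of_differentiableOn_of_addHaar_eq_zero volume ?_ h0'
        rw [hg]
        apply Differentiable.differentiableOn
        have : Differentiable ℝ fun x => τ.mulVec x :=
          (LinearMap.toContinuousLinearMap (Matrix.mulVecLin τ)).differentiable
        exact this.add_const _
      rw [Set.image_eq_preimage_of_inverse hl hr] at h0''
      constructor
      · rw [ae_iff]
        refine measure_mono_null ?_ (aux_pi_ac p h0')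
        intro x hx
        simp at hx ⊢
        exact hx.2
      · rw [ae_iff]
        refine measure_mono_null ?_ (aux_pi_ac p h0'')
        intro x hx
        simp at hx ⊢
        exact hx.2
    · have hid : ∀ x, g x = x := by
        intro x
        rw [hg, h1, h2]; simp
      exact ⟨ae_of_all _ fun x => Or.inl (hid x),
        ae_of_all _ fun z => Or.inl (by rw [← hid (gi z), hr z])⟩
  have mR2 : MeasurableSet {x | a ⬝ᵥ x < t} := measurableSet_lt ham measurable_const
  have mR3 : MeasurableSet {x | h x < k} := measurableSet_lt hhm measurable_const
  have hΦt : γ.real {x | a ⬝ᵥ x < t} = ((gaussianReal 0 1) (Set.Iio t)).toReal := by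
    rw [measureReal_def, aux_map_dot p a ha t]
  have hγE₁ : γ.real E₁ = γ.real (g ⁻¹' {x | a ⬝ᵥ x < t} ∩ {x | h x < k})
      + γ.real ({x | a ⬝ᵥ x < t} \ {x | h x < k}) := by
    rw [← measureReal_union _ (mR2.diff mR3)]
    · apply measureReal_congr
      filter_upwards [hbd.1] with x hx
      apply propext
      change (if k < h x then a ⬝ᵥ x < t else a ⬝ᵥ g x < t) ↔
        (a ⬝ᵥ g x < t ∧ h x < k) ∨ (a ⬝ᵥ x < t ∧ ¬ h x < k)
      rcases lt_trichotomy (h x) k with h1 | h1 | h1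
      · simp [h1, h1.le]
      · rcases hx with hx | hx
        · simp [h1, hx]
        · exact absurd h1 hx
      · simp [h1, h1.le]
    · rw [Set.disjoint_left]
      rintro x ⟨-, h1⟩ ⟨-, h2⟩
      exact h2 h1
  have hγE₂ : γ.real E₂ = γ.real (gi ⁻¹' {x | a ⬝ᵥ x < t} ∩ gi ⁻¹' {x | h x < k}ᶜ)
      + γ.real ({x | a ⬝ᵥ x < t} \ gi ⁻¹' {x | h x < k}ᶜ) := by
    rw [← measureReal_union _ (mR2.diff (hgim mR3.compl))]
    · apply measureReal_congr
      filter_upwards [hbd.2] with x hx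
      apply propext
      change (if k < h (gi x) then a ⬝ᵥ gi x < t else a ⬝ᵥ x < t) ↔
        (a ⬝ᵥ gi x < t ∧ ¬ h (gi x) < k) ∨ (a ⬝ᵥ x < t ∧ ¬ ¬ h (gi x) < k)
      rcases lt_trichotomy (h (gi x)) k with h1 | h1 | h1
      · simp [h1, h1.le]
      · rcases hx with hx | hx
        · rw [hx] at h1 ⊢
          simp [h1]
        · exact absurd h1 hx
      · simp [h1, h1.le]
    · rw [Set.disjoint_left]
      rintro x ⟨-, h1⟩ ⟨-, h2⟩
      exact h2 h1
  have d1 := measureReal_inter_add_sdiff (μ := γ) (s := {x | a ⬝ᵥ x < t}) mR3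
  have d2 := measureReal_inter_add_sdiff (μ := γ) (s := {x | a ⬝ᵥ x < t}) (hgim mR3.compl)
  rw [Set.image_eq_preimage_of_inverse hl hr]
  simp only [← measureReal_def]
  rw [← measureReal_def] at hΦt
  rw [hFt, ← hΦt, hγE₁, hγE₂]
  have : π₂ = 1 - π₁ := by linarith
  rw [this]
  linear_combination π₁ * d1 + (1 - π₁) * d2
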